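/- Let K be a 2n×2n real positive definite matrix and let Ω = Ω_n be the standard symplectic form. Define γ_K^# := K # (Ω K⁻¹ Ωᵀ), the geometric mean of K and Ω K⁻¹ Ωᵀ. Then: (a) γ_K^# = S Sᵀ for some symplectic matrix S (so γ_K^# is a pure quantum covariance matrix); and (b) the following are equivalent: the complex Hermitian matrix K − iΩ is positive definite; K − Ω K⁻¹ Ωᵀ is positive definite; K − γ_K^# is positive definite. -/

import Mathlib

open Matrix
open scoped ComplexOrder

/-- The standard symplectic form on `n` modes. -/
def Omg (n : ℕ) : Matrix (Fin n ⊕ Fin n) (Fin n ⊕ Fin n) ℝ :=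
  fromBlocks 0 1 (-1) 0

/-- A real matrix is symplectic (with respect to a given form `Ω`) if `S Ω Sᵀ = Ω`. -/
def IsSymplectic {N : Type*} [Fintype N] (Ω S : Matrix N N ℝ) : Prop :=
  S * Ω * Sᵀ = Ω

/-- Complexification of a real matrix. -/
noncomputable def cplx {μ ν : Type*} (M : Matrix μ ν ℝ) : Matrix μ ν ℂ :=
  M.map (fun x => (x : ℂ))

/-- The `t`-th power of a positive definite (more generally, Hermitian) real matrix,
defined through the spectral decomposition; junk value on non-Hermitian matrices. -/
noncomputable def mpow {N : Type*} [Fintype N] [DecidableEq N]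
    (M : Matrix N N ℝ) (t : ℝ) : Matrix N N ℝ :=
  if hM : M.IsHermitian then
    (hM.eigenvectorUnitary : Matrix N N ℝ) *
      Matrix.diagonal (fun i => hM.eigenvalues i ^ t) *
        star (hM.eigenvectorUnitary : Matrix N N ℝ)
  else M

/-- The geometric mean `A # B = A^{1/2} (A^{-1/2} B A^{-1/2})^{1/2} A^{1/2}` of positive
definite real matrices. -/
noncomputable def gm {N : Type*} [Fintype N] [DecidableEq N]
    (A B : Matrix N N ℝ) : Matrix N N ℝ :=
  mpow A (1 / 2) *
    mpow ((mpow A (1 / 2))⁻¹ * B * (mpow A (1 / 2))⁻¹) (1 / 2) *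
      mpow A (1 / 2)

theorem cplx_mul {l m k : Type*} [Fintype m] (A : Matrix l m ℝ) (B : Matrix m k ℝ) :
    cplx (A * B) = cplx A * cplx B :=
  Matrix.map_mul (f := Complex.ofRealHom)

theorem cplx_sub {m k : Type*} (A B : Matrix m k ℝ) : cplx (A - B) = cplx A - cplx B := by
  ext; simp [cplx]

theorem cplx_neg {m k : Type*} (A : Matrix m k ℝ) : cplx (-A) = -cplx A := by
  ext; simp [cplx]

theorem cplx_one {m : Type*} [DecidableEq m] : cplx (1 : Matrix m m ℝ) = 1 :=
  Matrix.map_one (fun x : ℝ => (x : ℂ)) Complex.ofReal_zero Complex.ofReal_one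

theorem cplx_transpose {m k : Type*} (A : Matrix m k ℝ) : (cplx A)ᵀ = cplx Aᵀ := rfl

theorem cplx_conjTranspose {m k : Type*} (A : Matrix m k ℝ) : (cplx A)ᴴ = cplx Aᵀ := by
  ext; simp [cplx]

/-- If `2 D - D L D` is positive definite with `L` positive semidefinite, so is `D`. -/
theorem posDef_of_two_smul_sub {N 𝕜 : Type*} [Fintype N] [RCLike 𝕜] {D L : Matrix N N 𝕜}
    (hD : D.IsHermitian) (hL : L.PosSemidef) (h : ((2 : ℝ) • D - D * L * D).PosDef) : D.PosDef := by
  have hs : (D * L * D).PosSemidef := by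
    have := hL.mul_mul_conjTranspose_same D
    rwa [hD.eq] at this
  have := (h.add_posSemidef hs).smul (show (0 : ℝ) < 1 / 2 by norm_num)
  rwa [sub_add_cancel, smul_smul, show (1 / 2 : ℝ) * 2 = 1 by norm_num, one_smul] at this

section MatrixOrderLemmas

variable {N : Type*} [Fintype N] [DecidableEq N]

theorem mpow_half_posDef {M : Matrix N N ℝ} (hM : M.PosDef) : (mpow M (1 / 2)).PosDef := by
  rw [mpow, dif_pos hM.1]
  refine (IsUnit.posDef_star_right_conjugate_iff
    (Unitary.isUnit_coe (U := hM.1.eigenvectorUnitary))).2 (PosDef.diagonal fun i => ?_)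
  exact Real.rpow_pos_of_pos (hM.eigenvalues_pos i) _

theorem mpow_half_mul_self {M : Matrix N N ℝ} (hM : M.PosDef) :
    mpow M (1 / 2) * mpow M (1 / 2) = M := by
  rw [mpow, dif_pos hM.1]
  have hU : star (hM.1.eigenvectorUnitary : Matrix N N ℝ) * hM.1.eigenvectorUnitary = 1 :=
    Unitary.coe_star_mul_self _
  have hD : diagonal (fun i => hM.1.eigenvalues i ^ (1 / 2 : ℝ)) *
      diagonal (fun i => hM.1.eigenvalues i ^ (1 / 2 : ℝ)) = diagonal hM.1.eigenvalues := by
    rw [diagonal_mul_diagonal]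
    congr 1
    ext i
    rw [← Real.rpow_add (hM.eigenvalues_pos i)]
    norm_num
  conv_rhs => rw [hM.1.spectral_theorem, Unitary.conjStarAlgAut_apply]
  change _ = _ * diagonal hM.1.eigenvalues * _
  rw [← hD]
  simp only [Matrix.mul_assoc]
  rw [← Matrix.mul_assoc (star _) _ (_ * _), hU, Matrix.one_mul]

open scoped MatrixOrder Matrix.Norms.L2Operator in
theorem eq_of_mul_self_eq {P Q : Matrix N N ℝ} (hP : P.PosDef) (hQ : Q.PosDef)
    (h : P * P = Q * Q) : P = Q := by
  have hP' : 0 ≤ P := nonneg_iff_posSemidef.2 hP.posSemidef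
  have hQ' : 0 ≤ Q := nonneg_iff_posSemidef.2 hQ.posSemidef
  rw [← CFC.sqrt_mul_self P hP', h, CFC.sqrt_mul_self Q hQ']

/-- Uniqueness of the positive definite solution of the Riccati equation `X K⁻¹ X = B`. -/
theorem eq_of_riccati {K X Y : Matrix N N ℝ} (hK : K.PosDef) (hX : X.PosDef) (hY : Y.PosDef)
    (h : X * K⁻¹ * X = Y * K⁻¹ * Y) : X = Y := by
  set A := mpow K (1 / 2) with hA
  have hAp : A.PosDef := mpow_half_posDef hK
  have hAu : IsUnit A.det := (isUnit_iff_isUnit_det A).1 hAp.isUnit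
  have hAA : A⁻¹ * A⁻¹ = K⁻¹ := by rw [← Matrix.mul_inv_rev, mpow_half_mul_self hK]
  have hpos : ∀ {Z : Matrix N N ℝ}, Z.PosDef → (A⁻¹ * Z * A⁻¹).PosDef := fun {Z} hZ => by
    have := (IsUnit.posDef_star_right_conjugate_iff hAp.inv.isUnit).2 hZ
    rwa [star_eq_conjTranspose, hAp.inv.1.eq] at this
  have hsq : ∀ Z : Matrix N N ℝ,
      A⁻¹ * Z * A⁻¹ * (A⁻¹ * Z * A⁻¹) = A⁻¹ * (Z * K⁻¹ * Z) * A⁻¹ := fun Z => by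
    rw [← hAA]
    simp only [Matrix.mul_assoc]
  have key := eq_of_mul_self_eq (hpos hX) (hpos hY) (by rw [hsq, hsq, h])
  have hback : ∀ Z : Matrix N N ℝ, A * (A⁻¹ * Z * A⁻¹) * A = Z := fun Z => by
    simp only [Matrix.mul_assoc]
    rw [Matrix.nonsing_inv_mul _ hAu, Matrix.mul_one, ← Matrix.mul_assoc,
      Matrix.mul_nonsing_inv _ hAu, Matrix.one_mul]
  rw [← hback X, key, hback]

theorem gm_aux_posDef {A B : Matrix N N ℝ} (hA : A.PosDef) (hB : B.PosDef) :
    ((mpow A (1 / 2))⁻¹ * B * (mpow A (1 / 2))⁻¹).PosDef := by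
  have hAp := (mpow_half_posDef hA).inv
  have := (IsUnit.posDef_star_right_conjugate_iff hAp.isUnit).2 hB
  rwa [star_eq_conjTranspose, hAp.1.eq] at this

theorem gm_posDef {A B : Matrix N N ℝ} (hA : A.PosDef) (hB : B.PosDef) : (gm A B).PosDef := by
  have hAp := mpow_half_posDef hA
  have := (IsUnit.posDef_star_right_conjugate_iff hAp.isUnit).2
    (mpow_half_posDef (gm_aux_posDef hA hB))
  rwa [star_eq_conjTranspose, hAp.1.eq] at this

theorem gm_riccati {A B : Matrix N N ℝ} (hA : A.PosDef) (hB : B.PosDef) :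
    gm A B * A⁻¹ * gm A B = B := by
  have hR := mpow_half_mul_self (gm_aux_posDef hA hB)
  have hAA := mpow_half_mul_self hA
  have hAu := (isUnit_iff_isUnit_det _).1 (mpow_half_posDef hA).isUnit
  rw [gm]
  set R := mpow ((mpow A (1 / 2))⁻¹ * B * (mpow A (1 / 2))⁻¹) (1 / 2)
  set C := mpow A (1 / 2)
  have hinv : A⁻¹ = C⁻¹ * C⁻¹ := by rw [← Matrix.mul_inv_rev, hAA]
  have h1 : C * C⁻¹ = 1 := Matrix.mul_nonsing_inv _ hAu
  have h2 : C⁻¹ * C = 1 := Matrix.nonsing_inv_mul _ hAu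
  calc C * R * C * A⁻¹ * (C * R * C) = C * R * (C * C⁻¹) * (C⁻¹ * C) * R * C := by
        rw [hinv]; simp only [Matrix.mul_assoc]
    _ = C * (R * R) * C := by rw [h1, h2]; simp only [Matrix.mul_assoc, Matrix.mul_one]
    _ = (C * C⁻¹) * B * (C⁻¹ * C) := by rw [hR]; simp only [Matrix.mul_assoc]
    _ = B := by rw [h1, h2, Matrix.one_mul, Matrix.mul_one]

variable {𝕜 : Type*} [RCLike 𝕜]

/-- The parallel sum `D (D + G)⁻¹ G` of positive definite matrices is positive definite. -/
theorem parallelSum_posDef {D G L : Matrix N N 𝕜} (hD : D.PosDef) (hG : G.PosDef)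
    (hL : L * (D + G) = 1) : (D * L * G).PosDef := by
  have hL' : (D + G) * L = 1 := mul_eq_one_comm.1 hL
  have hLi : L = (D + G)⁻¹ := (inv_eq_left_inv hL).symm
  have hLp : L.PosDef := hLi ▸ (hD.add hG).inv
  have hconj : ∀ {X Y : Matrix N N 𝕜}, X.PosDef → Y.PosDef → (X * L * Y * L * X).PosDef := by
    intro X Y hX hY
    have := (IsUnit.posDef_star_right_conjugate_iff (hX.isUnit.mul hLp.isUnit)).2 hY
    rwa [star_eq_conjTranspose, conjTranspose_mul, hX.1.eq, hLp.1.eq, ← Matrix.mul_assoc] at this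
  have hcomm : G * L * D = D * L * G := by
    have h1 : D * L * G = G - G * L * G := by
      calc D * L * G = ((D + G) * L) * G - G * L * G := by noncomm_ring
        _ = _ := by rw [hL', Matrix.one_mul]
    have h2 : G * L * D = G - G * L * G := by
      calc G * L * D = G * (L * (D + G)) - G * L * G := by noncomm_ring
        _ = _ := by rw [hL, Matrix.mul_one]
    rw [h1, h2]
  have : D * L * G = D * L * G * L * D + G * L * D * L * G := by
    rw [hcomm]
    calc D * L * G = D * L * G * (L * (D + G)) := by rw [hL, Matrix.mul_one]
      _ = _ := by noncomm_ring
  rw [this]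
  exact (hconj hD hG).add (hconj hG hD)

theorem cplx_posDef_iff {M : Matrix N N ℝ} : (cplx M).PosDef ↔ M.PosDef := by
  constructor
  · intro h
    refine PosDef.of_dotProduct_mulVec_pos ?_ fun x hx => ?_
    · ext i j
      have := h.1.apply i j
      simpa [cplx] using this
    · have hx' : (fun i => (x i : ℂ)) ≠ 0 := fun h0 => hx <| funext fun i => by
        simpa using congrFun h0 i
      have := h.dotProduct_mulVec_pos hx'
      have he : star (fun i => (x i : ℂ)) ⬝ᵥ (cplx M *ᵥ fun i => (x i : ℂ)) =
          ((star x ⬝ᵥ (M *ᵥ x) : ℝ) : ℂ) := by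
        simp [dotProduct, mulVec, cplx]
      rw [he] at this
      exact_mod_cast this
  · intro h
    have hA := mpow_half_posDef h
    have hAu := (isUnit_iff_isUnit_det _).1 hA.isUnit
    have hu : IsUnit (cplx (mpow M (1 / 2))) := IsUnit.of_mul_eq_one (cplx (mpow M (1 / 2))⁻¹) <| by
      rw [← cplx_mul, Matrix.mul_nonsing_inv _ hAu, cplx_one]
    have := (IsUnit.posDef_star_right_conjugate_iff hu).2 PosDef.one
    have ht : (mpow M (1 / 2))ᵀ = mpow M (1 / 2) := hA.1.eq
    rwa [star_eq_conjTranspose, cplx_conjTranspose, ht, Matrix.mul_one, ← cplx_mul,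
      mpow_half_mul_self h] at this

/-- `K - G > 0` iff `K - G K⁻¹ G > 0`. -/
theorem posDef_sub_iff_posDef_sub_riccati {K G : Matrix N N ℝ} (hK : K.PosDef) (hG : G.PosDef) :
    (K - G * K⁻¹ * G).PosDef ↔ (K - G).PosDef := by
  have hKu := (isUnit_iff_isUnit_det K).1 hK.isUnit
  have h1 : K * K⁻¹ = 1 := Matrix.mul_nonsing_inv _ hKu
  have h2 : K⁻¹ * K = 1 := Matrix.nonsing_inv_mul _ hKu
  constructor
  · intro h
    refine posDef_of_two_smul_sub (hK.1.sub hG.1) hK.inv.posSemidef ?_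
    have e : (2 : ℝ) • (K - G) - (K - G) * K⁻¹ * (K - G) = K - G * K⁻¹ * G := calc
      _ = (2 : ℝ) • (K - G) - ((K * K⁻¹) * (K - G) - G * (K⁻¹ * K) + G * K⁻¹ * G) := by
          noncomm_ring
      _ = K - G * K⁻¹ * G := by
          rw [h1, h2, Matrix.one_mul, Matrix.mul_one, two_smul]
          abel
    rwa [e]
  · intro h
    have hp := parallelSum_posDef h hG (L := K⁻¹) (by rw [sub_add_cancel, h2])
    have e : K - G * K⁻¹ * G = K - G + (K - G) * K⁻¹ * G := calc
      _ = K - G + (1 * G - G * K⁻¹ * G) := by noncomm_ring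
      _ = K - G + (K - G) * K⁻¹ * G := by rw [← h1]; noncomm_ring
    exact e ▸ h.add hp

/-- For real `K > 0` and antisymmetric `W`, `K - i W > 0` iff `K - W K⁻¹ Wᵀ > 0`. -/
theorem posDef_sub_I_smul_iff {K W : Matrix N N ℝ} (hK : K.PosDef) (hW : Wᵀ = -W) :
    (cplx K - Complex.I • cplx W).PosDef ↔ (K - W * K⁻¹ * Wᵀ).PosDef := by
  have hKu := (isUnit_iff_isUnit_det K).1 hK.isUnit
  have h1 : cplx K * cplx K⁻¹ = 1 := by
    rw [← cplx_mul, Matrix.mul_nonsing_inv _ hKu, cplx_one]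
  have h2 : cplx K⁻¹ * cplx K = 1 := mul_eq_one_comm.1 h1
  have hKt : Kᵀ = K := hK.1.eq
  have hWc := cplx_neg W
  have hT : (cplx K - Complex.I • cplx W)ᵀ = cplx K + Complex.I • cplx W := by
    rw [transpose_sub, transpose_smul, cplx_transpose, cplx_transpose, hKt, hW, hWc, smul_neg,
      sub_neg_eq_add]
  have hH : (cplx K - Complex.I • cplx W).IsHermitian := by
    rw [IsHermitian, conjTranspose_sub, conjTranspose_smul, cplx_conjTranspose,
      cplx_conjTranspose, hKt, hW, hWc]
    simp
  have hprod : cplx (K - W * K⁻¹ * Wᵀ) =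
      (cplx K - Complex.I • cplx W) * cplx K⁻¹ * (cplx K + Complex.I • cplx W) := by
    rw [hW, cplx_sub, cplx_mul, cplx_mul, hWc]
    simp only [sub_mul, mul_add, h1, smul_mul_assoc, mul_smul_comm, Matrix.mul_assoc, h2, one_mul,
      mul_one, mul_neg]
    match_scalars <;> simp
  rw [← cplx_posDef_iff (M := K - W * K⁻¹ * Wᵀ)]
  constructor
  · intro h
    have hG : (cplx K + Complex.I • cplx W).PosDef := hT ▸ h.transpose
    have hp := parallelSum_posDef h hG (L := (1 / 2 : ℝ) • cplx K⁻¹) (by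
      rw [sub_add_add_cancel, smul_mul_assoc, mul_add, h2]
      module)
    have := hp.smul (show (0 : ℝ) < 2 by norm_num)
    rwa [mul_smul_comm, smul_mul_assoc, smul_smul, show (2 : ℝ) * (1 / 2) = 1 by norm_num,
      one_smul, ← hprod] at this
  · intro h
    refine posDef_of_two_smul_sub hH (cplx_posDef_iff.2 hK.inv).posSemidef ?_
    rw [hprod] at h
    set D := cplx K - Complex.I • cplx W with hD
    have hG : cplx K + Complex.I • cplx W = (2 : ℝ) • cplx K - D := by
      rw [hD]
      module
    rwa [hG, mul_sub, mul_smul_comm, Matrix.mul_assoc D _ (cplx K), h2, Matrix.mul_one] at h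

/-- If `W` is orthogonal and antisymmetric, `P > 0` and `W P⁻¹ Wᵀ = P`, then `P W P = W`. -/
theorem mul_mul_self_eq_of_conj_inv {P W : Matrix N N ℝ} (hP : P.PosDef) (hWW : Wᵀ * W = 1)
    (h : W * P⁻¹ * Wᵀ = P) : P * W * P = W := by
  have hPu := (isUnit_iff_isUnit_det P).1 hP.isUnit
  calc P * W * P = W * P⁻¹ * Wᵀ * W * P := by rw [h]
    _ = W * P⁻¹ * (Wᵀ * W) * P := by simp only [Matrix.mul_assoc]
    _ = W := by rw [hWW, Matrix.mul_one, Matrix.mul_assoc, Matrix.nonsing_inv_mul _ hPu,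
      Matrix.mul_one]

theorem conj_posDef {P W : Matrix N N ℝ} (hP : P.PosDef) (hWW : Wᵀ * W = 1) :
    (W * P * Wᵀ).PosDef := by
  have hu : IsUnit W := IsUnit.of_mul_eq_one Wᵀ (mul_eq_one_comm.1 hWW)
  have := (IsUnit.posDef_star_right_conjugate_iff hu).2 hP
  rwa [star_eq_conjTranspose, conjTranspose_eq_transpose_of_trivial] at this

theorem gm_conj_inv {K W : Matrix N N ℝ} (hK : K.PosDef) (hW : Wᵀ = -W) (hWW : Wᵀ * W = 1) :
    W * (gm K (W * K⁻¹ * Wᵀ))⁻¹ * Wᵀ = gm K (W * K⁻¹ * Wᵀ) := by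
  have hB : (W * K⁻¹ * Wᵀ).PosDef := conj_posDef hK.inv hWW
  have hG := gm_posDef hK hB
  have hr := gm_riccati hK hB
  set G := gm K (W * K⁻¹ * Wᵀ)
  have hGu := (isUnit_iff_isUnit_det G).1 hG.isUnit
  refine eq_of_riccati hK (conj_posDef hG.inv hWW) hG ?_
  have hB' : Wᵀ * K⁻¹ * W = G * K⁻¹ * G := by
    rw [hr, hW]
    noncomm_ring
  calc W * G⁻¹ * Wᵀ * K⁻¹ * (W * G⁻¹ * Wᵀ) = W * G⁻¹ * (Wᵀ * K⁻¹ * W) * G⁻¹ * Wᵀ := by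
        simp only [Matrix.mul_assoc]
    _ = W * (G⁻¹ * G) * K⁻¹ * (G * G⁻¹) * Wᵀ := by
        rw [hB']
        simp only [Matrix.mul_assoc]
    _ = G * K⁻¹ * G := by
        rw [Matrix.nonsing_inv_mul _ hGu, Matrix.mul_nonsing_inv _ hGu, Matrix.mul_one,
          Matrix.mul_one, hr]

theorem mpow_half_conj_inv {G W : Matrix N N ℝ} (hG : G.PosDef) (hWW : Wᵀ * W = 1)
    (h : W * G⁻¹ * Wᵀ = G) : W * (mpow G (1 / 2))⁻¹ * Wᵀ = mpow G (1 / 2) := by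
  have hS := mpow_half_posDef hG
  have hSS := mpow_half_mul_self hG
  set S := mpow G (1 / 2)
  refine eq_of_mul_self_eq (conj_posDef hS.inv hWW) hS ?_
  calc W * S⁻¹ * Wᵀ * (W * S⁻¹ * Wᵀ) = W * S⁻¹ * (Wᵀ * W) * S⁻¹ * Wᵀ := by
        simp only [Matrix.mul_assoc]
    _ = W * (S⁻¹ * S⁻¹) * Wᵀ := by
        rw [hWW, Matrix.mul_one]
        simp only [Matrix.mul_assoc]
    _ = S * S := by rw [← Matrix.mul_inv_rev, hSS, h]

end MatrixOrderLemmas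

theorem Omg_transpose (n : ℕ) : (Omg n)ᵀ = -Omg n := by
  simp [Omg, fromBlocks_transpose, fromBlocks_neg]

theorem Omg_transpose_mul_self (n : ℕ) : (Omg n)ᵀ * Omg n = 1 := by
  simp [Omg, fromBlocks_transpose, fromBlocks_multiply]

/-- for `K > 0`, the matrix `γ_K^# = K # (Ω K⁻¹ Ωᵀ)` is a pure QCM, and
`K − iΩ > 0 ⟺ K − Ω K⁻¹ Ωᵀ > 0 ⟺ K − γ_K^# > 0`. -/
theorem stmt11 {n : ℕ} (K : Matrix (Fin n ⊕ Fin n) (Fin n ⊕ Fin n) ℝ)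
    (hK : K.PosDef) :
    (∃ S, IsSymplectic (Omg n) S ∧ gm K (Omg n * K⁻¹ * (Omg n)ᵀ) = S * Sᵀ) ∧
      (((cplx K - Complex.I • cplx (Omg n)).PosDef ↔
          (K - Omg n * K⁻¹ * (Omg n)ᵀ).PosDef) ∧
        ((cplx K - Complex.I • cplx (Omg n)).PosDef ↔
          (K - gm K (Omg n * K⁻¹ * (Omg n)ᵀ)).PosDef)) := by
  have hWW := Omg_transpose_mul_self n
  have hB := conj_posDef hK.inv hWW
  have hG := gm_posDef hK hB
  have hS := mpow_half_posDef hG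
  have hSt : (mpow (gm K (Omg n * K⁻¹ * (Omg n)ᵀ)) (1 / 2))ᵀ = _ := hS.1.eq
  refine ⟨⟨mpow (gm K (Omg n * K⁻¹ * (Omg n)ᵀ)) (1 / 2), ?_, ?_⟩,
    posDef_sub_I_smul_iff hK (Omg_transpose n), ?_⟩
  · rw [IsSymplectic, hSt]
    exact mul_mul_self_eq_of_conj_inv hS hWW
      (mpow_half_conj_inv hG hWW (gm_conj_inv hK (Omg_transpose n) hWW))
  · rw [hSt, mpow_half_mul_self hG]
  · rw [posDef_sub_I_smul_iff hK (Omg_transpose n),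
      ← posDef_sub_iff_posDef_sub_riccati hK hG, gm_riccati hK hB]
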